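/- The coinvariant lattice of the curve representation under ℤ₃×ℤ₃, namely the quotient L / I where I is the ℤ-span of {x − g₁·x : x ∈ L} ∪ {x − g₂·x : x ∈ L}, is isomorphic as an abelian group to ℤ³ ⊕ ℤ/3 ⊕ ℤ/3. (This is the computation H₂(X̃,ℤ)_G ≅ ℤ³ ⊕ ℤ₃ ⊕ ℤ₃, whose torsion part gives the torsion curve classes of the quotient threefold.) -/

import Mathlib

open Matrix

/-- The generator `g₁` of the ℤ₃×ℤ₃ action on the degree-2 homology lattice of the
ℤ₃×ℤ₃-symmetric dP₉ surface, in the basis (σ, f, θ₁₁, θ₂₁, θ₃₁, θ₃₂, θ₄₁, θ₄₂, μ, ν). -/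
def g1mat : Matrix (Fin 10) (Fin 10) ℤ :=
  !![0,0,0,3,0,0,0,0,-1,-1;
     0,1,0,3,0,1,0,1,-1,-1;
     0,0,1,0,0,0,0,0,0,0;
     0,0,0,-2,0,0,0,0,1,0;
     0,0,0,-2,0,-1,0,0,1,1;
     0,0,0,-1,1,-1,0,0,0,1;
     0,0,0,-2,0,0,0,-1,1,1;
     0,0,0,-1,0,0,1,-1,0,0;
     1,0,0,-3,0,0,0,0,2,1;
     0,0,0,0,0,0,0,0,0,1]

/-- The generator `g₂` of the ℤ₃×ℤ₃ action. -/
def g2mat : Matrix (Fin 10) (Fin 10) ℤ :=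
  !![0,0,3,0,0,0,0,0,-1,-1;
     0,1,3,0,1,0,0,1,-1,-1;
     0,0,-2,0,0,0,0,0,0,1;
     0,0,0,1,0,0,0,0,0,0;
     0,0,-1,0,-1,1,0,0,1,0;
     0,0,-2,0,-1,0,0,0,1,1;
     0,0,-2,0,0,0,0,-1,1,1;
     0,0,-1,0,0,0,1,-1,0,0;
     0,0,0,0,0,0,0,0,1,0;
     1,0,-3,0,0,0,0,0,1,2]

/-- The fiber class `f`. -/
def fvec : Fin 10 → ℤ := ![0,1,0,0,0,0,0,0,0,0]

/-- The ambient rank-20 lattice ℤ¹⁰ ⊕ ℤ¹⁰. -/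
abbrev Wlat := (Fin 10 → ℤ) × (Fin 10 → ℤ)

/-- The linear form ℓ(x) = x₁ + x₉ + x₁₀. -/
def ell (x : Fin 10 → ℤ) : ℤ := x 0 + x 8 + x 9

/-- The diagonal action of a matrix `g` on ℤ¹⁰ ⊕ ℤ¹⁰. -/
def act (g : Matrix (Fin 10) (Fin 10) ℤ) (x : Wlat) : Wlat :=
  (g.mulVec x.1, g.mulVec x.2)

/-- The rank-19 lattice `L = {(a,b) : ℓ(a) = ℓ(b)}` realizing the curve
representation `R = H₂(X̃,ℤ)` of ℤ₃×ℤ₃ on the curve classes of the covering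
Calabi-Yau threefold `X̃`. -/
def Lsub : Submodule ℤ Wlat where
  carrier := {x | ell x.1 = ell x.2}
  add_mem' := by
    intro a b ha hb
    simp only [Set.mem_setOf_eq, ell, Prod.fst_add, Prod.snd_add, Pi.add_apply] at *
    omega
  zero_mem' := by simp [ell]
  smul_mem' := by
    intro c x hx
    simp only [Set.mem_setOf_eq, ell, Prod.smul_fst, Prod.smul_snd, Pi.smul_apply,
      smul_eq_mul] at *
    linear_combination c * hx

/-- The submodule of relations `I = span_ℤ({x − g₁·x : x ∈ L} ∪ {x − g₂·x : x ∈ L})`. -/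
def Isub : Submodule ℤ Wlat :=
  Submodule.span ℤ
    {y : Wlat | ∃ x : Wlat, ell x.1 = ell x.2 ∧ (y = x - act g1mat x ∨ y = x - act g2mat x)}

/-- First coefficient vector of the explicit decomposition of a kernel element. -/
def uvec (a b : Fin 10 → ℤ) (s t : ℤ) : Wlat :=
  (![-6 * a 1 - 4 * a 2 - 3 * a 3 - 2 * a 6 - 2 * a 7 - a 8,
     0,
     0,
     -s,
     3 * a 1 + 2 * a 2 + a 3 + a 4 + a 6 + a 7 - s - t,
     3 * a 1 + 2 * a 2 + 2 * a 3 + a 6 + a 7,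
     4 * a 1 + 2 * a 2 + 2 * a 3 + 2 * a 6 + a 7 - s + t,
     2 * a 1 + a 2 + a 3 + a 6 + a 7,
     -a 3 - 3 * s,
     6 * a 1 + 4 * a 2 + 4 * a 3 + 2 * a 6 + 2 * a 7],
   ![-a 8 - a 9 - 3 * b 1 - b 2 - b 3 - b 4 - b 5 - 3 * s + 3 * t,
     0,
     0,
     0,
     b 1 + b 2 + b 4,
     2 * b 1 + b 2 + b 3 + b 4 + b 5,
     -b 7,
     0,
     -b 3,
     a 9 + 3 * b 1 + b 2 + 2 * b 3 + b 4 + b 5 - 3 * t])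

/-- Second coefficient vector of the explicit decomposition of a kernel element. -/
def vvec (a b : Fin 10 → ℤ) (s t : ℤ) : Wlat :=
  (![a 2 - a 9,
     0,
     t,
     0,
     0,
     0,
     0,
     0,
     0,
     -a 2 + 3 * t],
   ![0,
     0,
     0,
     0,
     0,
     0,
     0,
     0,
     -a 9 + b 2 + 3 * t,
     -b 2])

/-- The classifying homomorphism on the ambient lattice. -/
def phi0 : Wlat →+ (Fin 3 → ℤ) × (ZMod 3 × ZMod 3) where
  toFun x :=
    (![3 * x.1 1 + x.1 2 + x.1 3 + x.1 4 + x.1 5 + x.1 6 + x.1 7,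
       3 * x.2 1 + x.2 2 + x.2 3 + x.2 4 + x.2 5 + x.2 6 + x.2 7,
       x.1 0 + x.1 8 + x.1 9],
     ((x.2 8 - x.1 8 : ℤ) : ZMod 3), ((x.1 9 + x.2 0 + x.2 8 : ℤ) : ZMod 3))
  map_zero' := by
    ext i
    · fin_cases i <;> simp
    · simp
    · simp
  map_add' x y := by
    ext i
    · fin_cases i <;> simp <;> ring
    · simp; ring
    · simp; ring

/-- The classifying homomorphism restricted to `L`. -/
def phi : Lsub →ₗ[ℤ] (Fin 3 → ℤ) × (ZMod 3 × ZMod 3) :=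
  phi0.toIntLinearMap.comp Lsub.subtype

theorem phi_surj : Function.Surjective phi := by
  rintro ⟨p, s, t⟩
  obtain ⟨s, rfl⟩ := ZMod.intCast_surjective s
  obtain ⟨t, rfl⟩ := ZMod.intCast_surjective t
  refine ⟨⟨(![p 2 - (t - s), 0, p 0, 0, 0, 0, 0, 0, 0, t - s],
    ![0, 0, p 1, 0, 0, 0, 0, 0, s, p 2 - s]), ?_⟩, ?_⟩
  · change ell _ = ell _
    simp [ell]
  · ext i
    · fin_cases i <;> simp [phi, phi0]
    · simp [phi, phi0]
    · simp [phi, phi0]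

theorem phi0_eq_zero_iff (x : Wlat) : phi0 x = 0 ↔
    3 * x.1 1 + x.1 2 + x.1 3 + x.1 4 + x.1 5 + x.1 6 + x.1 7 = 0 ∧
    3 * x.2 1 + x.2 2 + x.2 3 + x.2 4 + x.2 5 + x.2 6 + x.2 7 = 0 ∧
    x.1 0 + x.1 8 + x.1 9 = 0 ∧ (3 : ℤ) ∣ x.2 8 - x.1 8 ∧
    (3 : ℤ) ∣ x.1 9 + x.2 0 + x.2 8 := by
  have h1 := ZMod.intCast_zmod_eq_zero_iff_dvd (x.2 8 - x.1 8) 3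
  have h2 := ZMod.intCast_zmod_eq_zero_iff_dvd (x.1 9 + x.2 0 + x.2 8) 3
  rw [← Nat.cast_ofNat (R := ℤ) (n := 3)] at *
  rw [← h1, ← h2]
  simp only [phi0, AddMonoidHom.coe_mk, ZeroHom.coe_mk, Prod.ext_iff, funext_iff,
    Fin.forall_fin_succ]
  simp
  tauto

theorem g1_mulVec (x : Fin 10 → ℤ) : g1mat.mulVec x =
    ![3 * x 3 - x 8 - x 9, x 1 + 3 * x 3 + x 5 + x 7 - x 8 - x 9, x 2, -2 * x 3 + x 8,
      -2 * x 3 - x 5 + x 8 + x 9, -x 3 + x 4 - x 5 + x 9, -2 * x 3 - x 7 + x 8 + x 9,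
      -x 3 + x 6 - x 7, x 0 - 3 * x 3 + 2 * x 8 + x 9, x 9] := by
  ext i
  fin_cases i <;> simp [g1mat, dotProduct, Fin.sum_univ_succ] <;> ring

theorem g2_mulVec (x : Fin 10 → ℤ) : g2mat.mulVec x =
    ![3 * x 2 - x 8 - x 9, x 1 + 3 * x 2 + x 4 + x 7 - x 8 - x 9, -2 * x 2 + x 9, x 3,
      -x 2 - x 4 + x 5 + x 8, -2 * x 2 - x 4 + x 8 + x 9, -2 * x 2 - x 7 + x 8 + x 9,
      -x 2 + x 6 - x 7, x 8, x 0 - 3 * x 2 + x 8 + 2 * x 9] := by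
  ext i
  fin_cases i <;> simp [g2mat, dotProduct, Fin.sum_univ_succ] <;> ring

theorem phi0_act (g : Matrix (Fin 10) (Fin 10) ℤ) (hg : g = g1mat ∨ g = g2mat) (x : Wlat)
    (hx : ell x.1 = ell x.2) : phi0 (x - act g x) = 0 := by
  obtain ⟨a, b⟩ := x
  rw [phi0_eq_zero_iff]
  simp only [ell] at hx
  rcases hg with rfl | rfl
  all_goals
    simp only [act, Prod.fst_sub, Prod.snd_sub, Pi.sub_apply, g1_mulVec, g2_mulVec]
    simp only [Matrix.cons_val]
    refine ⟨?_, ?_, ?_, ?_, ?_⟩ <;> omega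

set_option maxHeartbeats 4000000 in
theorem decomp (a b : Fin 10 → ℤ) (s t : ℤ)
    (hab : a 0 + a 8 + a 9 = b 0 + b 8 + b 9)
    (h0 : 3 * a 1 + a 2 + a 3 + a 4 + a 5 + a 6 + a 7 = 0)
    (h1 : 3 * b 1 + b 2 + b 3 + b 4 + b 5 + b 6 + b 7 = 0)
    (h2 : a 0 + a 8 + a 9 = 0) (h3 : b 8 - a 8 = 3 * s) (h4 : a 9 + b 0 + b 8 = 3 * t) :
    ((a, b) : Wlat) = (uvec a b s t - act g1mat (uvec a b s t)) +
      (vvec a b s t - act g2mat (vvec a b s t)) := by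
  ext i
  all_goals
    fin_cases i <;>
    simp [act, g1_mulVec, g2_mulVec, uvec, vvec] <;>
    omega

theorem uvec_ell (a b : Fin 10 → ℤ) (s t : ℤ) :
    ell (uvec a b s t).1 = ell (uvec a b s t).2 := by
  simp [ell, uvec]
  try ring

theorem vvec_ell (a b : Fin 10 → ℤ) (s t : ℤ) :
    ell (vvec a b s t).1 = ell (vvec a b s t).2 := by
  simp [ell, vvec]
  try ring

theorem ker_phi : Isub.comap Lsub.subtype = LinearMap.ker phi := by
  ext ⟨x, hx⟩
  rw [Submodule.mem_comap, LinearMap.mem_ker]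
  change x ∈ Isub ↔ phi0 x = 0
  constructor
  · intro h
    have hle : Isub ≤ LinearMap.ker phi0.toIntLinearMap := by
      refine Submodule.span_le.2 ?_
      rintro y ⟨z, hz, rfl | rfl⟩
      · exact phi0_act _ (Or.inl rfl) z hz
      · exact phi0_act _ (Or.inr rfl) z hz
    exact hle h
  · intro h
    obtain ⟨a, b⟩ := x
    obtain ⟨h0, h1, h2, ⟨s, h3⟩, ⟨t, h4⟩⟩ := (phi0_eq_zero_iff _).1 h
    rw [decomp a b s t hx h0 h1 h2 h3 h4]
    exact Submodule.add_mem _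
      (Submodule.subset_span ⟨_, uvec_ell a b s t, Or.inl rfl⟩)
      (Submodule.subset_span ⟨_, vvec_ell a b s t, Or.inr rfl⟩)

/-- The coinvariant lattice of the curve representation under ℤ₃×ℤ₃, i.e. the quotient
`L/I`, is isomorphic as an abelian group to `ℤ³ ⊕ ℤ/3 ⊕ ℤ/3`.  This is the computation
`H₂(X̃,ℤ)_G ≅ ℤ³ ⊕ ℤ₃ ⊕ ℤ₃`, whose torsion part gives the torsion curve classes of the
quotient threefold. -/
theorem coinvariant_curve_lattice :
    Nonempty ((↥Lsub ⧸ (Isub.comap Lsub.subtype)) ≃ₗ[ℤ]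
      ((Fin 3 → ℤ) × (ZMod 3 × ZMod 3))) := by
  exact ⟨(Submodule.quotEquivOfEq _ _ ker_phi).trans
    (phi.quotKerEquivOfSurjective phi_surj)⟩
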